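/- Let W_m ⊆ W_n ⊆ V be finite nonempty sets and z ∈ W_m. Let (Y^m_k)_{k≥0} be a Markov chain on B₁W_m with kernel p_{W_m} started at z, and let (Y^n_j)_{j≥0} be a Markov chain on B₁W_n with kernel p_{W_n} started at z. Define random indices J_0 := 0 and, recursively for k ≥ 1, J_k := J_{k−1} + 1 if Y^n_{J_{k−1}} ∈ W_m, and J_k := min{j > J_{k−1} : Y^n_j ∈ W_m} otherwise. Then almost surely every J_k is finite, and the process (Y^n_{J_k})_{k≥0} has the same law as (Y^m_k)_{k≥0}: for every k ≥ 0 and all s_0, …, s_k ∈ B₁W_m, P[Y^n_{J_0} = s_0, …, Y^n_{J_k} = s_k] = P[Y^m_0 = s_0, …, Y^m_k = s_k]. (The consistency of the approximating Markov chains, the paper's Lemma 3.3.) -/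

import Mathlib

open scoped ENNReal

noncomputable section

/-- The Dirichlet energy `(1/2) Σ_{x,y} c(x,y) (f(y) - f(x))²`, valued in `[0,∞]`. -/
def energy {V : Type*} (c : V → V → ℝ) (f : V → ℝ) : ℝ≥0∞ :=
  (1 / 2 : ℝ≥0∞) * ∑' x : V, ∑' y : V, ENNReal.ofReal (c x y * (f y - f x) ^ 2)

/-- A conductance function: symmetric, nonnegative, vanishing on the diagonal,
connected (via the adjacency relation `0 < c x y`), and with `π(x) = Σ_y c(x,y) < ∞`
for every `x` (expressed as summability of the nonnegative family `c x ·`). -/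
def Conductance {V : Type*} (c : V → V → ℝ) : Prop :=
  (∀ x y, c x y = c y x) ∧ (∀ x y, 0 ≤ c x y) ∧ (∀ x, c x x = 0) ∧
  (∀ x y, Relation.ReflTransGen (fun a b => 0 < c a b) x y) ∧
  (∀ x, Summable fun y => c x y)


open MeasureTheory
open scoped Classical

/-- The `1`-neighborhood `B₁W = W ∪ {x : x ∼ y for some y ∈ W}` of a finite set `W`. -/
def B1 {V : Type*} (c : V → V → ℝ) (W : Finset V) : Set V :=
  ↑W ∪ {x | ∃ y ∈ W, 0 < c x y}

/-- The transition kernel `p_W`: from `x ∈ W`, random-walk steps `c(x,y)/π(x)`;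
from `x ∉ W`, jump into `W` according to the energy-minimizing harmonic measure
`hm_W^x(y) = H y x` (and probability `0` to points outside `W`). -/
def pW {V : Type*} (c : V → V → ℝ) (W : Finset V) (H : V → V → ℝ) (x y : V) : ℝ :=
  if x ∈ W then c x y / (∑' z, c x z) else if y ∈ W then H y x else 0

namespace DirichletForm

variable {V : Type*} {c : V → V → ℝ}

/-- The summand of the Dirichlet form of `f` and `g`, indexed by ordered pairs of vertices. -/
def density (c : V → V → ℝ) (f g : V → ℝ) (p : V × V) : ℝ :=
  c p.1 p.2 * ((f p.2 - f p.1) * (g p.2 - g p.1))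

/-- The Dirichlet form, normalised so that `form c f f` is twice the energy of `f`. -/
def form (c : V → V → ℝ) (f g : V → ℝ) : ℝ := ∑' p, density c f g p

lemma density_self_nonneg (hc : Conductance c) (f : V → ℝ) (p : V × V) :
    0 ≤ density c f f p :=
  mul_nonneg (hc.2.1 _ _) (mul_self_nonneg _)

/-- Functions of finite Dirichlet energy. -/
def FiniteEnergy (c : V → V → ℝ) (f : V → ℝ) : Prop := Summable (density c f f)

lemma FiniteEnergy.summable_density (hc : Conductance c) {f g : V → ℝ}
    (hf : FiniteEnergy c f) (hg : FiniteEnergy c g) : Summable (density c f g) := by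
  refine Summable.of_norm_bounded (hf.add hg) fun p => ?_
  have h0 := hc.2.1 p.1 p.2
  simp only [density, Real.norm_eq_abs, abs_mul, abs_of_nonneg h0]
  rw [← mul_add]
  refine mul_le_mul_of_nonneg_left ?_ h0
  rw [← abs_mul_abs_self (f p.2 - f p.1), ← abs_mul_abs_self (g p.2 - g p.1)]
  nlinarith [sq_nonneg (|f p.2 - f p.1| - |g p.2 - g p.1|),
    sq_nonneg (|f p.2 - f p.1|), sq_nonneg (|g p.2 - g p.1|)]

lemma FiniteEnergy.add (hc : Conductance c) {f g : V → ℝ}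
    (hf : FiniteEnergy c f) (hg : FiniteEnergy c g) : FiniteEnergy c (f + g) := by
  have h := (Summable.add hf hg).add ((hf.summable_density hc hg).mul_left 2)
  refine h.congr fun p => ?_
  simp only [density, Pi.add_apply]
  ring

lemma FiniteEnergy.smul {f : V → ℝ} (hf : FiniteEnergy c f) (t : ℝ) :
    FiniteEnergy c (t • f) := by
  refine (Summable.mul_left (t ^ 2) hf).congr fun p => ?_
  simp only [density, Pi.smul_apply, smul_eq_mul]
  ring

lemma finiteEnergy_const (a : ℝ) : FiniteEnergy c fun _ => a := by
  exact summable_zero.congr fun p => by simp [density]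

lemma FiniteEnergy.sum (hc : Conductance c) {ι : Type*} (s : Finset ι) (f : ι → V → ℝ)
    (hf : ∀ i ∈ s, FiniteEnergy c (f i)) : FiniteEnergy c (∑ i ∈ s, f i) :=
  Finset.sum_induction f (FiniteEnergy c) (fun _ _ => FiniteEnergy.add hc)
    (finiteEnergy_const 0) hf

lemma form_comm (f g : V → ℝ) : form c f g = form c g f :=
  tsum_congr fun p => by simp only [density]; ring

lemma form_add_left (hc : Conductance c) {f g h : V → ℝ} (hf : FiniteEnergy c f)
    (hg : FiniteEnergy c g) (hh : FiniteEnergy c h) :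
    form c (f + g) h = form c f h + form c g h := by
  rw [form, form, form,
    ← (hf.summable_density hc hh).tsum_add (hg.summable_density hc hh)]
  refine tsum_congr fun p => ?_
  simp only [density, Pi.add_apply]
  ring

lemma form_smul_left (t : ℝ) (f h : V → ℝ) : form c (t • f) h = t * form c f h := by
  rw [form, form, ← tsum_mul_left]
  refine tsum_congr fun p => ?_
  simp only [density, Pi.smul_apply, smul_eq_mul]
  ring

lemma energy_eq_tsum_density (f : V → ℝ) :
    energy c f = (1 / 2 : ℝ≥0∞) * ∑' p, ENNReal.ofReal (density c f f p) := by
  rw [energy, ENNReal.tsum_prod']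
  simp only [density, sq]

lemma FiniteEnergy.energy_eq (hc : Conductance c) {f : V → ℝ} (hf : FiniteEnergy c f) :
    energy c f = (1 / 2 : ℝ≥0∞) * ENNReal.ofReal (form c f f) := by
  rw [energy_eq_tsum_density, form, ENNReal.ofReal_tsum_of_nonneg (density_self_nonneg hc f) hf]

lemma finiteEnergy_of_energy_ne_top (hc : Conductance c) {f : V → ℝ} (hf : energy c f ≠ ∞) :
    FiniteEnergy c f := by
  have h : ∑' p, ENNReal.ofReal (density c f f p) ≠ ∞ := by
    intro h
    rw [energy_eq_tsum_density, h] at hf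
    simp at hf
  refine (ENNReal.summable_toReal h).congr fun p => ?_
  exact ENNReal.toReal_ofReal (density_self_nonneg hc f p)

lemma FiniteEnergy.energy_ne_top (hc : Conductance c) {f : V → ℝ} (hf : FiniteEnergy c f) :
    energy c f ≠ ∞ := by
  rw [hf.energy_eq hc]
  exact ENNReal.mul_ne_top (by simp) ENNReal.ofReal_ne_top

lemma form_self_nonneg (hc : Conductance c) (f : V → ℝ) : 0 ≤ form c f f :=
  tsum_nonneg (density_self_nonneg hc f)

lemma form_self_le_of_energy_le (hc : Conductance c) {f g : V → ℝ} (hf : FiniteEnergy c f)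
    (hg : FiniteEnergy c g) (h : energy c f ≤ energy c g) : form c f f ≤ form c g g := by
  rw [hf.energy_eq hc, hg.energy_eq hc,
    ENNReal.mul_le_mul_iff_right (by simp) (by simp)] at h
  exact (ENNReal.ofReal_le_ofReal_iff (form_self_nonneg hc g)).1 h

lemma energy_abs_le (hc : Conductance c) (f : V → ℝ) : energy c |f| ≤ energy c f := by
  refine mul_le_mul_right (ENNReal.tsum_le_tsum fun x => ENNReal.tsum_le_tsum fun y => ?_) _
  refine ENNReal.ofReal_le_ofReal (mul_le_mul_of_nonneg_left ?_ (hc.2.1 x y))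
  exact sq_le_sq.2 (abs_abs_sub_abs_le_abs_sub (f y) (f x))

/-- Finite-energy functions orthogonal to every finite-energy function vanishing on `A`. -/
def HarmonicOff (c : V → V → ℝ) (A : Finset V) (f : V → ℝ) : Prop :=
  FiniteEnergy c f ∧ ∀ g, FiniteEnergy c g → (∀ a ∈ A, g a = 0) → form c f g = 0

lemma HarmonicOff.add (hc : Conductance c) {A : Finset V} {f g : V → ℝ}
    (hf : HarmonicOff c A f) (hg : HarmonicOff c A g) : HarmonicOff c A (f + g) :=
  ⟨hf.1.add hc hg.1, fun k hk hk0 => by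
    rw [form_add_left hc hf.1 hg.1 hk, hf.2 k hk hk0, hg.2 k hk hk0, add_zero]⟩

lemma HarmonicOff.smul {A : Finset V} {f : V → ℝ} (hf : HarmonicOff c A f) (t : ℝ) :
    HarmonicOff c A (t • f) :=
  ⟨hf.1.smul t, fun k hk hk0 => by rw [form_smul_left, hf.2 k hk hk0, mul_zero]⟩

lemma harmonicOff_const (A : Finset V) (a : ℝ) : HarmonicOff c A fun _ => a :=
  ⟨finiteEnergy_const a, fun g _ _ => by simp [form, density]⟩

lemma HarmonicOff.sum (hc : Conductance c) {A : Finset V} {ι : Type*} (s : Finset ι)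
    (f : ι → V → ℝ) (hf : ∀ i ∈ s, HarmonicOff c A (f i)) :
    HarmonicOff c A (∑ i ∈ s, f i) :=
  Finset.sum_induction f (HarmonicOff c A) (fun _ _ => HarmonicOff.add hc)
    (harmonicOff_const A 0) hf

lemma eq_of_form_self_eq_zero (hc : Conductance c) {f : V → ℝ} (hf : FiniteEnergy c f)
    (h : form c f f = 0) (x y : V) : f x = f y := by
  have h0 : density c f f = 0 :=
    (hasSum_zero_iff_of_nonneg (density_self_nonneg hc f)).1 (by
      rw [← h]
      exact Summable.hasSum hf)
  induction hc.2.2.2.1 x y with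
  | refl => rfl
  | @tail a b _ hab ih =>
    have h1 : c a b * ((f b - f a) * (f b - f a)) = 0 := congrFun h0 (a, b)
    rcases mul_eq_zero.1 h1 with h2 | h2
    · exact absurd h2 hab.ne'
    · rw [ih]
      linarith [mul_self_eq_zero.1 h2]

/-- A harmonic function is determined by its values on the boundary. -/
lemma HarmonicOff.ext (hc : Conductance c) {A : Finset V} (hA : A.Nonempty) {f g : V → ℝ}
    (hf : HarmonicOff c A f) (hg : HarmonicOff c A g) (h : ∀ a ∈ A, f a = g a) : f = g := by
  obtain ⟨a, ha⟩ := hA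
  have hd : HarmonicOff c A (f + (-1 : ℝ) • g) := hf.add hc (hg.smul _)
  have h0 := hd.2 _ hd.1 fun b hb => by simp [h b hb]
  funext x
  have := eq_of_form_self_eq_zero hc hd.1 h0 x a
  simp only [Pi.add_apply, Pi.smul_apply, smul_eq_mul, h a ha] at this
  linarith

lemma hasSum_density_single (hc : Conductance c) {f : V → ℝ} (a : V) {S : ℝ}
    (h : HasSum (fun y => c a y * (f y - f a)) S) :
    HasSum (density c f (Pi.single a 1)) (-2 * S) := by
  have hr : Function.Injective fun y : V => (a, y) := Prod.mk_right_injective a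
  have hl : Function.Injective fun x : V => (x, a) := Prod.mk_left_injective a
  have h1 : HasSum (fun p : V × V => if p.1 = a then c p.1 p.2 * (f p.2 - f p.1) else 0) S := by
    rw [← hr.hasSum_iff]
    · simpa [Function.comp_def] using h
    · rintro ⟨x, y⟩ hxy
      have : x ≠ a := fun hx => hxy ⟨y, by simp [hx]⟩
      simp [this]
  have h2 : HasSum (fun p : V × V => if p.2 = a then c p.1 p.2 * (f p.2 - f p.1) else 0) (-S) := by
    rw [← hl.hasSum_iff]
    · refine h.neg.congr_fun fun x => ?_
      simp only [Function.comp_apply, if_true, hc.1 x a]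
      ring
    · rintro ⟨x, y⟩ hxy
      have : y ≠ a := fun hy => hxy ⟨x, by simp [hy]⟩
      simp [this]
  rw [show -2 * S = -S - S by ring]
  refine (h2.sub h1).congr_fun fun p => ?_
  simp only [density, Pi.single_apply]
  split_ifs <;> ring

lemma finiteEnergy_single (hc : Conductance c) (a : V) :
    FiniteEnergy c (Pi.single a (1 : ℝ)) := by
  have h : Summable fun y => c a y * ((Pi.single a (1 : ℝ) : V → ℝ) y
      - (Pi.single a (1 : ℝ) : V → ℝ) a) := by
    refine (hc.2.2.2.2 a).neg.congr fun y => ?_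
    rcases eq_or_ne y a with rfl | hy
    · simp [hc.2.2.1]
    · simp [hy]
  exact (hasSum_density_single hc a h.hasSum).summable

/-- An energy minimiser with prescribed values on `A` is harmonic off `A`. -/
lemma harmonicOff_of_minimal (hc : Conductance c) {A : Finset V} {f : V → ℝ}
    (hf : FiniteEnergy c f)
    (hmin : ∀ g, (∀ a ∈ A, g a = f a) → energy c f ≤ energy c g) : HarmonicOff c A f := by
  refine ⟨hf, fun g hg hg0 => ?_⟩
  have key : ∀ t : ℝ, 0 ≤ 2 * t * form c f g + t ^ 2 * form c g g := by
    intro t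
    have hft := hf.add hc (hg.smul t)
    have h := form_self_le_of_energy_le hc hf hft
      (hmin _ fun a ha => by simp [hg0 a ha])
    rw [form_add_left hc hf (hg.smul t) hft, form_smul_left, form_comm f (f + t • g),
      form_comm g (f + t • g),
      form_add_left hc hf (hg.smul t) hf, form_add_left hc hf (hg.smul t) hg,
      form_smul_left, form_smul_left, form_comm g f] at h
    linarith
  have hd := discrim_le_zero (a := form c g g) (b := 2 * form c f g) (c := 0)
    fun t => by linarith [key t]
  rw [discrim] at hd
  nlinarith [sq_nonneg (form c f g)]

/-- A family `H` whose member `H y`, for `y ∈ A`, minimises the energy among the functions equal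
to `1` at `y` and `0` on the rest of `A`. -/
structure IsHarmonicMeasure (c : V → V → ℝ) (A : Finset V) (H : V → V → ℝ) : Prop where
  boundary : ∀ y ∈ A, H y y = 1 ∧ ∀ a ∈ A, a ≠ y → H y a = 0
  minimal : ∀ y ∈ A, ∀ f : V → ℝ,
    (f y = 1 ∧ ∀ a ∈ A, a ≠ y → f a = 0) → energy c (H y) ≤ energy c f

variable {A : Finset V} {H : V → V → ℝ}

lemma IsHarmonicMeasure.apply_boundary (hH : IsHarmonicMeasure c A H) {y a : V} (hy : y ∈ A)
    (ha : a ∈ A) : H y a = if a = y then 1 else 0 := by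
  split_ifs with h
  · rw [h, (hH.boundary y hy).1]
  · exact (hH.boundary y hy).2 a ha h

lemma IsHarmonicMeasure.harmonicOff (hc : Conductance c) (hH : IsHarmonicMeasure c A H) {y : V}
    (hy : y ∈ A) : HarmonicOff c A (H y) := by
  refine harmonicOff_of_minimal hc (finiteEnergy_of_energy_ne_top hc ?_) fun g hg => ?_
  · refine ne_top_of_le_ne_top ((finiteEnergy_single hc y).energy_ne_top hc)
      (hH.minimal y hy _ ?_)
    exact ⟨by simp, fun a _ ha => by simp [ha]⟩
  · refine hH.minimal y hy g ⟨?_, fun a ha hay => ?_⟩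
    · rw [hg y hy, (hH.boundary y hy).1]
    · rw [hg a ha, (hH.boundary y hy).2 a ha hay]

lemma IsHarmonicMeasure.nonneg (hc : Conductance c) (hH : IsHarmonicMeasure c A H) {y : V}
    (hy : y ∈ A) (x : V) : 0 ≤ H y x := by
  have hh := hH.harmonicOff hc hy
  have hb : ∀ a ∈ A, |H y| a = H y a := fun a ha => by
    rw [Pi.abs_apply, hH.apply_boundary hy ha]
    split_ifs <;> simp
  have ha : HarmonicOff c A |H y| := by
    refine harmonicOff_of_minimal hc (finiteEnergy_of_energy_ne_top hc ?_) fun g hg => ?_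
    · exact ne_top_of_le_ne_top (hh.1.energy_ne_top hc) (energy_abs_le hc _)
    · refine (energy_abs_le hc _).trans (hH.minimal y hy g ⟨?_, fun a ha hay => ?_⟩)
      · rw [hg y hy, hb y hy, (hH.boundary y hy).1]
      · rw [hg a ha, hb a ha, (hH.boundary y hy).2 a ha hay]
  rw [← ha.ext hc ⟨y, hy⟩ hh hb]
  exact abs_nonneg _

lemma IsHarmonicMeasure.sum_smul_apply (hH : IsHarmonicMeasure c A H) (φ : V → ℝ) {a : V}
    (ha : a ∈ A) : (∑ y ∈ A, φ y • H y) a = φ a := by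
  rw [Finset.sum_apply, Finset.sum_eq_single_of_mem a ha fun b hb hba => ?_]
  · simp [hH.apply_boundary ha ha]
  · simp [hH.apply_boundary hb ha, hba.symm]

lemma IsHarmonicMeasure.harmonicOff_sum_smul (hc : Conductance c) (hH : IsHarmonicMeasure c A H)
    (φ : V → ℝ) : HarmonicOff c A (∑ y ∈ A, φ y • H y) :=
  HarmonicOff.sum hc _ _ fun _ hy => (hH.harmonicOff hc hy).smul _

lemma IsHarmonicMeasure.sum_eq_one (hc : Conductance c) (hH : IsHarmonicMeasure c A H)
    (hA : A.Nonempty) (x : V) : ∑ y ∈ A, H y x = 1 := by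
  have h := (hH.harmonicOff_sum_smul hc fun _ => 1).ext hc hA (harmonicOff_const A 1)
    fun a ha => hH.sum_smul_apply _ ha
  simpa using congrFun h x

/-- A function that is the harmonic extension of its values on `B` and satisfies the mean value
property at the points of `B ∖ A` is harmonic off `A`. -/
lemma HarmonicOff.of_subset (hc : Conductance c) {A B : Finset V} {u : V → ℝ}
    (hu : HarmonicOff c B u)
    (hmean : ∀ a ∈ B, a ∉ A → HasSum (fun y => c a y * (u y - u a)) 0) : HarmonicOff c A u := by
  refine ⟨hu.1, fun g hg hg0 => ?_⟩
  set s : V → ℝ := ∑ a ∈ B, g a • Pi.single a (1 : ℝ) with hs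
  have hsF : FiniteEnergy c s :=
    FiniteEnergy.sum hc _ _ fun a _ => (finiteEnergy_single hc a).smul _
  have hsu : form c s u = 0 := by
    have : FiniteEnergy c s ∧ form c s u = 0 := by
      refine Finset.sum_induction _ (fun k => FiniteEnergy c k ∧ form c k u = 0)
        (fun k l hk hl => ⟨hk.1.add hc hl.1, ?_⟩) ⟨finiteEnergy_const 0, ?_⟩
        fun a ha => ⟨(finiteEnergy_single hc a).smul _, ?_⟩
      · rw [form_add_left hc hk.1 hl.1 hu.1, hk.2, hl.2, add_zero]
      · simp [form, density]
      · rw [form_smul_left, form_comm]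
        by_cases haA : a ∈ A
        · rw [hg0 a haA, zero_mul]
        · rw [form, (hasSum_density_single hc a (hmean a ha haA)).tsum_eq]
          simp
    exact this.2
  have hr : form c u (g + (-1 : ℝ) • s) = 0 := by
    refine hu.2 _ (hg.add hc (hsF.smul _)) fun a ha => ?_
    have : s a = g a := by
      simp [hs, Finset.sum_apply, Pi.single_apply, ha]
    simp [this]
  rw [form_comm, form_add_left hc hg (hsF.smul _) hu.1, form_smul_left, hsu] at hr
  rw [form_comm]
  simpa using hr

lemma tsum_conductance_pos [Infinite V] (hc : Conductance c) (x : V) : 0 < ∑' y, c x y := by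
  obtain ⟨y, hy⟩ := exists_ne x
  obtain ⟨b, hb, -⟩ := (Relation.ReflTransGen.cases_head (hc.2.2.2.1 x y)).resolve_left hy.symm
  exact (hc.2.2.2.2 x).tsum_pos (hc.2.1 x) b hb

end DirichletForm

namespace MarkovHitting

variable {V : Type*}

/-- The probability that a chain with kernel `q` started at `x` avoids `A` at times `1, …, r`
and is at `y` at time `r + 1`. -/
def hitAt (q : V → V → ℝ≥0∞) (A : Finset V) : ℕ → V → V → ℝ≥0∞
  | 0, x, y => q x y
  | r + 1, x, y => ∑' x', if x' ∈ A then 0 else q x x' * hitAt q A r x' y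

/-- The kernel of the chain with kernel `q` watched, while outside `A`, only on `A`. -/
def watched (q : V → V → ℝ≥0∞) (A : Finset V) (x y : V) : ℝ≥0∞ :=
  if x ∈ A then q x y else if y ∈ A then ∑' r, hitAt q A r x y else 0

variable {q : V → V → ℝ≥0∞} {A : Finset V}

lemma tsum_hitAt_le_one (hq : ∀ x, ∑' y, q x y ≤ 1) {y : V} (hy : y ∈ A) (x : V) :
    ∑' r, hitAt q A r x y ≤ 1 := by
  refine ENNReal.tsum_le_of_sum_range_le fun n => ?_
  induction n generalizing x with
  | zero => simp
  | succ n ih =>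
    rw [Finset.sum_range_succ']
    simp only [hitAt]
    rw [← Summable.tsum_finsetSum fun _ _ => ENNReal.summable,
      ← tsum_ite_eq y fun _ => q x y, ← ENNReal.tsum_add]
    refine (ENNReal.tsum_le_tsum fun x' => ?_).trans (hq x)
    by_cases hx' : x' ∈ A
    · simp only [hx', if_true, Finset.sum_const_zero, zero_add]
      split_ifs with h
      · rw [h]
      · exact zero_le
    · have : x' ≠ y := fun h => hx' (h ▸ hy)
      simp only [hx', if_false, this, add_zero, ← Finset.mul_sum]
      exact mul_le_of_le_one_right' (ih x')

lemma tsum_hitAt_eq (x y : V) :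
    ∑' r, hitAt q A r x y
      = q x y + ∑' x', if x' ∈ A then 0 else q x x' * ∑' r, hitAt q A r x' y := by
  rw [tsum_eq_zero_add' ENNReal.summable]
  simp only [hitAt]
  rw [ENNReal.tsum_comm]
  congr 1
  refine tsum_congr fun x' => ?_
  split_ifs
  · simp
  · rw [ENNReal.tsum_mul_left]

/-- The probability of hitting `A` first at `y`, time zero included. -/
def hitProb (q : V → V → ℝ≥0∞) (A : Finset V) (y x : V) : ℝ≥0∞ :=
  if x ∈ A then if x = y then 1 else 0 else ∑' r, hitAt q A r x y

lemma hitProb_eq_tsum {x y : V} (hx : x ∉ A) (hy : y ∈ A) :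
    hitProb q A y x = ∑' x', q x x' * hitProb q A y x' := by
  rw [hitProb, if_neg hx, tsum_hitAt_eq, ← tsum_ite_eq y fun _ => q x y, ← ENNReal.tsum_add]
  refine tsum_congr fun x' => ?_
  by_cases hx' : x' ∈ A
  · rw [hitProb, if_pos hx', if_pos hx', add_zero]
    split_ifs with h <;> simp [h]
  · have : x' ≠ y := fun h => hx' (h ▸ hy)
    simp [hitProb, hx', this]

lemma hitProb_le_one (hq : ∀ x, ∑' y, q x y ≤ 1) {y : V} (hy : y ∈ A) (x : V) :
    hitProb q A y x ≤ 1 := by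
  unfold hitProb
  split_ifs
  · exact le_rfl
  · exact zero_le_one
  · exact tsum_hitAt_le_one hq hy x

end MarkovHitting

namespace DirichletForm

open MarkovHitting

variable {V : Type*} {c : V → V → ℝ} {A B : Finset V} {H K : V → V → ℝ}

lemma pW_nonneg (hc : Conductance c) (hH : IsHarmonicMeasure c A H) (x y : V) :
    0 ≤ pW c A H x y := by
  unfold pW
  split_ifs with h1 h2
  · exact div_nonneg (hc.2.1 x y) (tsum_nonneg (hc.2.1 x))
  · exact hH.nonneg hc h2 x
  · exact le_rfl

lemma hasSum_pW_of_notMem {x : V} (hx : x ∉ A) (u : V → ℝ) :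
    HasSum (fun y => pW c A H x y * u y) (∑ y ∈ A, H y x * u y) := by
  have h : ∀ y ∈ A, pW c A H x y * u y = H y x * u y := fun y hy => by simp [pW, hx, hy]
  rw [← Finset.sum_congr rfl h]
  exact hasSum_sum_of_ne_finset_zero fun y hy => by simp [pW, hx, hy]

lemma tsum_ofReal_pW_le_one (hc : Conductance c) (hA : A.Nonempty)
    (hH : IsHarmonicMeasure c A H) (x : V) : ∑' y, ENNReal.ofReal (pW c A H x y) ≤ 1 := by
  have key : Summable (pW c A H x) ∧ ∑' y, pW c A H x y ≤ 1 := by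
    by_cases hx : x ∈ A
    · have h := (hc.2.2.2.2 x).hasSum.div_const (∑' y, c x y)
      have h2 : HasSum (pW c A H x) ((∑' y, c x y) / ∑' y, c x y) :=
        h.congr_fun fun y => by simp [pW, hx]
      exact ⟨h2.summable, h2.tsum_eq ▸ div_self_le_one _⟩
    · have h := hasSum_pW_of_notMem (c := c) (H := H) hx fun _ => 1
      simp only [mul_one, hH.sum_eq_one hc hA] at h
      exact ⟨h.summable, h.tsum_eq.le⟩
  rw [← ENNReal.ofReal_tsum_of_nonneg (pW_nonneg hc hH x) key.1]
  exact ENNReal.ofReal_le_one.2 key.2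

/-- Bounded functions satisfying the mean value property for `p_B` off `A ⊆ B` are harmonic
off `A`. -/
lemma harmonicOff_of_hasSum_pW [Infinite V] (hc : Conductance c) (hAB : A ⊆ B)
    (hK : IsHarmonicMeasure c B K) {u : V → ℝ}
    (hu : ∀ x, x ∉ A → HasSum (fun y => pW c B K x y * u y) (u x)) : HarmonicOff c A u := by
  refine HarmonicOff.of_subset (B := B) hc ?_ fun a haB haA => ?_
  · have h : u = ∑ y ∈ B, u y • K y := by
      funext x
      by_cases hx : x ∈ B
      · exact (hK.sum_smul_apply u hx).symm
      · have := (hu x fun h => hx (hAB h)).unique (hasSum_pW_of_notMem hx u)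
        simpa [Finset.sum_apply, mul_comm] using this
    rw [h]
    exact hK.harmonicOff_sum_smul hc u
  · have hpos := tsum_conductance_pos hc a
    have h1 := (hu a haA).mul_left (∑' y, c a y)
    have h2 := (hc.2.2.2.2 a).hasSum.mul_right (u a)
    have h3 := h1.sub h2
    rw [sub_self] at h3
    refine h3.congr_fun fun y => ?_
    simp only [pW, haB, if_true]
    field_simp

/-- Hitting probabilities of `A` for the chain with kernel `p_B`, `A ⊆ B`, are given by the
harmonic measure of `A`. -/
lemma watched_pW [Infinite V] (hc : Conductance c) (hA : A.Nonempty) (hAB : A ⊆ B)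
    (hH : IsHarmonicMeasure c A H) (hK : IsHarmonicMeasure c B K) (x y : V) :
    watched (fun x y => ENNReal.ofReal (pW c B K x y)) A x y = ENNReal.ofReal (pW c A H x y) := by
  set q : V → V → ℝ≥0∞ := fun x y => ENNReal.ofReal (pW c B K x y) with hq
  have hq1 : ∀ x, ∑' y, q x y ≤ 1 := tsum_ofReal_pW_le_one hc (hA.mono hAB) hK
  by_cases hx : x ∈ A
  · simp [watched, pW, hx, hAB hx, hq]
  by_cases hy : y ∈ A
  swap
  · simp [watched, pW, hx, hy]
  have hfin : ∀ x, hitProb q A y x ≠ ∞ := fun x =>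
    ne_top_of_le_ne_top ENNReal.one_ne_top (hitProb_le_one hq1 hy x)
  have hu : HarmonicOff c A fun x => (hitProb q A y x).toReal := by
    refine harmonicOff_of_hasSum_pW hc hAB hK fun x hx => ?_
    have h := hitProb_eq_tsum (q := q) hx hy
    have hs := ENNReal.hasSum_toReal (h ▸ hfin x)
    rw [← ENNReal.tsum_toReal_eq (ENNReal.ne_top_of_tsum_ne_top (h ▸ hfin x)), ← h] at hs
    refine hs.congr_fun fun x' => ?_
    rw [ENNReal.toReal_mul, ENNReal.toReal_ofReal (pW_nonneg hc hK x x')]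
  have h := hu.ext hc hA (hH.harmonicOff hc hy) fun a ha => by
    rw [hH.apply_boundary hy ha, hitProb, if_pos ha]
    split_ifs <;> simp
  have hx' := congrFun h x
  simp only [hitProb, if_neg hx] at hx'
  have hfx := hfin x
  simp only [hitProb, if_neg hx] at hfx
  simp only [watched, pW, hx, hy, if_true, if_false]
  rw [← hx', ENNReal.ofReal_toReal hfx]

end DirichletForm

namespace MarkovHitting

section Path

variable {V Ω : Type*} {Y : ℕ → Ω → V} {A : Finset V} {N : ℕ} {S : Set Ω}

/-- The event `S` depends only on the path of `Y` up to time `N`. -/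
def DeterminedBy (Y : ℕ → Ω → V) (N : ℕ) (S : Set Ω) : Prop :=
  ∀ ω ω', (∀ i ≤ N, Y i ω = Y i ω') → ω ∈ S → ω' ∈ S

lemma DeterminedBy.mono {M : ℕ} (hS : DeterminedBy Y N S) (h : N ≤ M) : DeterminedBy Y M S :=
  fun ω ω' hω => hS ω ω' fun i hi => hω i (hi.trans h)

lemma DeterminedBy.inter {T : Set Ω} (hS : DeterminedBy Y N S) (hT : DeterminedBy Y N T) :
    DeterminedBy Y N (S ∩ T) :=
  fun ω ω' hω h => ⟨hS ω ω' hω h.1, hT ω ω' hω h.2⟩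

lemma determinedBy_eq (N : ℕ) (x : V) : DeterminedBy Y N {ω | Y N ω = x} :=
  fun _ _ hω h => (hω N le_rfl).symm.trans h

/-- `Y` avoids `A` at times `N + 1, …, N + r`. -/
def Avoids (Y : ℕ → Ω → V) (A : Finset V) (N r : ℕ) (ω : Ω) : Prop :=
  ∀ j, N < j → j ≤ N + r → Y j ω ∉ A

lemma determinedBy_avoids (A : Finset V) (N r : ℕ) :
    DeterminedBy Y (N + r) {ω | Avoids Y A N r ω} :=
  fun _ _ hω h j hj hj' => hω j hj' ▸ h j hj hj'

/-- Seen from time `N`, the next observation time is `M`: it is `N + 1` if `Y` is in `A` at time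
`N`, and otherwise the first later time at which `Y` is in `A`. -/
def NextVisit (Y : ℕ → Ω → V) (A : Finset V) (N M : ℕ) (ω : Ω) : Prop :=
  N < M ∧ (Y N ω ∈ A → M = N + 1) ∧ (Y N ω ∉ A → Y M ω ∈ A ∧ ∀ j, N < j → j < M → Y j ω ∉ A)

lemma determinedBy_nextVisit (A : Finset V) (N M : ℕ) :
    DeterminedBy Y M {ω | NextVisit Y A N M ω} := by
  rintro ω ω' hω ⟨h1, h2, h3⟩
  refine ⟨h1, ?_, ?_⟩
  · rw [← hω N h1.le]
    exact h2
  · rw [← hω N h1.le, ← hω M le_rfl]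
    exact fun h => ⟨(h3 h).1, fun j hj hjM => hω j hjM.le ▸ (h3 h).2 j hj hjM⟩

lemma NextVisit.unique {M M' : ℕ} {ω : Ω} (h : NextVisit Y A N M ω)
    (h' : NextVisit Y A N M' ω) : M = M' := by
  by_cases hN : Y N ω ∈ A
  · rw [h.2.1 hN, h'.2.1 hN]
  · rcases lt_trichotomy M M' with hlt | heq | hlt
    · exact absurd (h.2.2 hN).1 ((h'.2.2 hN).2 M h.1 hlt)
    · exact heq
    · exact absurd (h'.2.2 hN).1 ((h.2.2 hN).2 M' h'.1 hlt)

lemma nextVisit_iff {M : ℕ} {ω : Ω} :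
    NextVisit Y A N M ω ↔
      N < (if Y N ω ∈ A then N + 1 else sInf {j | N < j ∧ Y j ω ∈ A}) ∧
        (if Y N ω ∈ A then N + 1 else sInf {j | N < j ∧ Y j ω ∈ A}) = M := by
  by_cases hN : Y N ω ∈ A
  · simp only [NextVisit, hN, if_true, not_true_eq_false, false_imp_iff, and_true, true_imp_iff]
    omega
  · simp only [NextVisit, hN, if_false, not_false_eq_true, true_imp_iff, false_imp_iff, true_and]
    constructor
    · rintro ⟨h1, h2, h3⟩
      have : sInf {j | N < j ∧ Y j ω ∈ A} = M := by
        refine le_antisymm (Nat.sInf_le ⟨h1, h2⟩) (le_csInf ⟨M, h1, h2⟩ fun j hj => ?_)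
        exact not_lt.1 fun hjM => h3 j hj.1 hjM hj.2
      exact ⟨this ▸ h1, this⟩
    · rintro ⟨h1, rfl⟩
      have hne : {j | N < j ∧ Y j ω ∈ A}.Nonempty := by
        by_contra hne
        rw [Set.not_nonempty_iff_eq_empty.1 hne] at h1
        simp at h1
      exact ⟨h1, (Nat.sInf_mem hne).2, fun j hj hjM hjA => Nat.notMem_of_lt_sInf hjM ⟨hj, hjA⟩⟩

lemma nextVisit_add_iff {r : ℕ} {ω : Ω} (hN : Y N ω ∉ A) :
    NextVisit Y A N (N + r + 1) ω ↔ Avoids Y A N r ω ∧ Y (N + r + 1) ω ∈ A := by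
  simp only [NextVisit, hN, false_imp_iff, true_and, not_false_eq_true, true_imp_iff, Avoids,
    Nat.lt_succ_iff]
  constructor
  · exact fun h => ⟨h.2.2, h.2.1⟩
  · exact fun h => ⟨by omega, h.2, h.1⟩

lemma exists_nextVisit_of_mem {j : ℕ} {ω : Ω} (hj : N < j) (hjA : Y j ω ∈ A) :
    ∃ M, NextVisit Y A N M ω := by
  refine ⟨_, nextVisit_iff.2 ⟨?_, rfl⟩⟩
  split_ifs
  · exact N.lt_succ_self
  · exact (Nat.sInf_mem ⟨j, hj, hjA⟩ : _ ∈ {j | N < j ∧ Y j ω ∈ A}).1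

/-- The event that the first `k` steps between observation times are proper, the observed values
are `s 0, …, s k` and the last observation time is `N`. -/
def observed (Y : ℕ → Ω → V) (J : ℕ → Ω → ℕ) (s : ℕ → V) (k N : ℕ) : Set Ω :=
  {ω | (∀ i < k, J i ω < J (i + 1) ω) ∧ (∀ i ≤ k, Y (J i ω) ω = s i) ∧ J k ω = N}

variable {J : ℕ → Ω → ℕ}

lemma mem_observed_succ
    (hJ : ∀ k M ω, NextVisit Y A (J k ω) M ω ↔ J k ω < J (k + 1) ω ∧ J (k + 1) ω = M)
    {s : ℕ → V} {k M : ℕ} {ω : Ω} :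
    ω ∈ observed Y J s (k + 1) M ↔
      ∃ N, ω ∈ observed Y J s k N ∧ NextVisit Y A N M ω ∧ Y M ω = s (k + 1) := by
  constructor
  · rintro ⟨h1, h2, rfl⟩
    exact ⟨J k ω, ⟨fun i hi => h1 i (by omega), fun i hi => h2 i (by omega), rfl⟩,
      (hJ _ _ _).2 ⟨h1 k k.lt_succ_self, rfl⟩, h2 _ le_rfl⟩
  · rintro ⟨N, ⟨h1, h2, rfl⟩, h3, h4⟩
    obtain ⟨h5, rfl⟩ := (hJ _ _ _).1 h3
    refine ⟨fun i hi => ?_, fun i hi => ?_, rfl⟩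
    · rcases (Nat.le_of_lt_succ hi).lt_or_eq with hi | rfl
      exacts [h1 i hi, h5]
    · rcases hi.lt_or_eq with hi | rfl
      exacts [h2 i (Nat.le_of_lt_succ hi), h4]

lemma determinedBy_observed (hJ0 : ∀ ω, J 0 ω = 0)
    (hJ : ∀ k M ω, NextVisit Y A (J k ω) M ω ↔ J k ω < J (k + 1) ω ∧ J (k + 1) ω = M)
    (s : ℕ → V) (k N : ℕ) : DeterminedBy Y N (observed Y J s k N) := by
  induction k generalizing N with
  | zero =>
    rintro ω ω' hω ⟨-, h, rfl⟩
    refine ⟨by simp, fun i hi => ?_, by simp [hJ0]⟩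
    have h0 := h i hi
    obtain rfl : i = 0 := by omega
    rw [hJ0] at h0 ⊢
    rw [← h0, hω 0 (Nat.zero_le _)]
  | succ k ih =>
    intro ω ω' hω h
    obtain ⟨M, h1, h2, h3⟩ := (mem_observed_succ hJ).1 h
    exact (mem_observed_succ hJ).2 ⟨M, (ih M).mono h2.1.le ω ω' hω h1,
      determinedBy_nextVisit A M N ω ω' hω h2, determinedBy_eq N _ ω ω' hω h3⟩

end Path

variable {V Ω : Type*} [MeasurableSpace Ω] {P : Measure Ω} {Y : ℕ → Ω → V} {z : V}
  {q : V → V → ℝ≥0∞} {A : Finset V} {N : ℕ} {S : Set Ω} {x y : V}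

/-- The laws of the finite paths of `Y` are those of the Markov chain with kernel `q` started
at `z`. -/
structure IsMarkovChain (P : Measure Ω) (Y : ℕ → Ω → V) (q : V → V → ℝ≥0∞) (z : V) : Prop where
  measurableSet : ∀ (j : ℕ) (s : V), MeasurableSet {ω | Y j ω = s}
  path : ∀ (k : ℕ) (s : ℕ → V), P {ω | ∀ i ≤ k, Y i ω = s i} =
    (if s 0 = z then 1 else 0) * ∏ i ∈ Finset.range k, q (s i) (s (i + 1))

lemma measure_eq_tsum_fiber {T : Type*} [Countable T] (f : Ω → T)
    (hf : ∀ t, MeasurableSet {ω | f ω = t}) (hS : MeasurableSet S) :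
    P S = ∑' t, P (S ∩ {ω | f ω = t}) := by
  rw [← measure_iUnion (fun t t' htt' => ?_) fun t => hS.inter (hf t)]
  · congr 1
    ext ω
    simp
  · exact Set.disjoint_left.2 fun ω h h' => htt' (h.2.symm.trans h'.2)

lemma IsMarkovChain.measurableSet_path (hY : IsMarkovChain P Y q z) (N : ℕ)
    (t : Fin (N + 1) → V) : MeasurableSet {ω | (fun i : Fin (N + 1) => Y i ω) = t} := by
  simp only [funext_iff, Set.ofPred_forall]
  exact .iInter fun i => hY.measurableSet i (t i)

variable [Countable V]

lemma DeterminedBy.measurableSet (hY : IsMarkovChain P Y q z) (hS : DeterminedBy Y N S) :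
    MeasurableSet S := by
  have h : S = ⋃ t ∈ (fun ω (i : Fin (N + 1)) => Y i ω) '' S,
      {ω | (fun i : Fin (N + 1) => Y i ω) = t} := by
    ext ω
    simp only [Set.mem_iUnion, Set.mem_image, Set.mem_ofPred_eq, exists_prop]
    refine ⟨fun h => ⟨_, ⟨ω, h, rfl⟩, rfl⟩, ?_⟩
    rintro ⟨t, ⟨ω', h', rfl⟩, h⟩
    exact hS ω' ω (fun i hi => (congrFun h ⟨i, Nat.lt_succ_of_le hi⟩).symm) h'
  rw [h]
  exact .biUnion (Set.to_countable _) fun t _ => hY.measurableSet_path N t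

/-- The Markov property at a fixed time. -/
lemma IsMarkovChain.measure_inter_next (hY : IsMarkovChain P Y q z) (hS : DeterminedBy Y N S)
    (hx : ∀ ω ∈ S, Y N ω = x) (y : V) : P (S ∩ {ω | Y (N + 1) ω = y}) = P S * q x y := by
  have hSm := hS.measurableSet hY
  rw [measure_eq_tsum_fiber _ (hY.measurableSet_path N) (hSm.inter (hY.measurableSet _ _)),
    measure_eq_tsum_fiber _ (hY.measurableSet_path N) hSm, ← ENNReal.tsum_mul_right]
  refine tsum_congr fun t => ?_
  rcases (S ∩ {ω | (fun i : Fin (N + 1) => Y i ω) = t}).eq_empty_or_nonempty with h | ⟨ω₀, h₀, ht⟩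
  · rw [Set.inter_right_comm, h]
    simp
  · set s : ℕ → V := fun i => if i ≤ N then Y i ω₀ else y with hs
    have hst : S ∩ {ω | (fun i : Fin (N + 1) => Y i ω) = t} = {ω | ∀ i ≤ N, Y i ω = s i} := by
      ext ω
      refine ⟨fun h i hi => ?_, fun h => ?_⟩
      · simp only [hs, hi, if_true]
        exact congrFun (h.2.trans ht.symm) ⟨i, Nat.lt_succ_of_le hi⟩
      · have h' : ∀ i ≤ N, Y i ω = Y i ω₀ := fun i hi => by simpa [hs, hi] using h i hi
        refine ⟨hS ω₀ ω (fun i hi => (h' i hi).symm) h₀, Eq.trans ?_ ht⟩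
        funext i
        exact h' i (Nat.le_of_lt_succ i.2)
    have hst' : S ∩ {ω | (fun i : Fin (N + 1) => Y i ω) = t} ∩ {ω | Y (N + 1) ω = y}
        = {ω | ∀ i ≤ N + 1, Y i ω = s i} := by
      rw [hst]
      ext ω
      refine ⟨fun h i hi => ?_, fun h => ⟨fun i hi => h i (hi.trans N.le_succ), ?_⟩⟩
      · rcases hi.lt_or_eq with hi | rfl
        · exact h.1 i (Nat.le_of_lt_succ hi)
        · simpa [hs] using h.2
      · simpa [hs] using h (N + 1) le_rfl
    rw [Set.inter_right_comm, hst', hst, hY.path, hY.path, Finset.prod_range_succ, mul_assoc]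
    simp [hs, hx ω₀ h₀]

lemma IsMarkovChain.measure_inter_avoids (hY : IsMarkovChain P Y q z) (A : Finset V) (r : ℕ)
    (hS : DeterminedBy Y N S) (hx : ∀ ω ∈ S, Y N ω = x) (y : V) :
    P (S ∩ {ω | Avoids Y A N r ω ∧ Y (N + r + 1) ω = y}) = P S * hitAt q A r x y := by
  induction r generalizing N S x with
  | zero =>
    rw [hitAt, ← hY.measure_inter_next hS hx y]
    congr 1
    ext ω
    simp only [Avoids, Set.mem_inter_iff, Set.mem_ofPred_eq]
    refine and_congr_right fun _ => and_iff_right fun j hj hj' => ?_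
    omega
  | succ r ih =>
    have hm : MeasurableSet (S ∩ {ω | Avoids Y A N (r + 1) ω ∧ Y (N + (r + 1) + 1) ω = y}) :=
      (hS.measurableSet hY).inter
        (((determinedBy_avoids A N (r + 1)).measurableSet hY).inter (hY.measurableSet _ _))
    rw [measure_eq_tsum_fiber _ (hY.measurableSet (N + 1)) hm, hitAt, ← ENNReal.tsum_mul_left]
    refine tsum_congr fun x' => ?_
    split_ifs with hx'
    · rw [mul_zero]
      convert measure_empty (μ := P)
      refine Set.eq_empty_iff_forall_notMem.2 fun ω h => ?_
      exact h.1.2.1 (N + 1) (by omega) (by omega) (h.2 ▸ hx')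
    · have hS' : DeterminedBy Y (N + 1) (S ∩ {ω | Y (N + 1) ω = x'}) :=
        (hS.mono N.le_succ).inter (determinedBy_eq _ _)
      rw [← mul_assoc, ← hY.measure_inter_next hS hx x', ← ih hS' fun ω h => h.2]
      congr 1
      ext ω
      have e : N + (r + 1) + 1 = N + 1 + r + 1 := by omega
      simp only [Avoids, Set.mem_inter_iff, Set.mem_ofPred_eq, e]
      constructor
      · rintro ⟨⟨h1, h2, h3⟩, h4⟩
        exact ⟨⟨h1, h4⟩, fun j hj hj' => h2 j (by omega) (by omega), h3⟩
      · rintro ⟨⟨h1, h4⟩, h2, h3⟩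
        refine ⟨⟨h1, fun j hj hj' => ?_, h3⟩, h4⟩
        rcases (Nat.succ_le_of_lt hj).lt_or_eq with hj | rfl
        · exact h2 j hj (by omega)
        · exact h4 ▸ hx'

lemma IsMarkovChain.measurableSet_nextVisit_eq (hY : IsMarkovChain P Y q z) (A : Finset V)
    (N : ℕ) (y : V) : MeasurableSet {ω | ∃ M, NextVisit Y A N M ω ∧ Y M ω = y} := by
  rw [Set.ofPred_exists]
  exact .iUnion fun M =>
    ((determinedBy_nextVisit A N M).inter (determinedBy_eq M y)).measurableSet hY

/-- The strong Markov property at the next observation time. -/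
lemma IsMarkovChain.measure_inter_nextVisit (hY : IsMarkovChain P Y q z) (A : Finset V)
    (hS : DeterminedBy Y N S) (hx : ∀ ω ∈ S, Y N ω = x) (y : V) :
    P (S ∩ {ω | ∃ M, NextVisit Y A N M ω ∧ Y M ω = y}) = P S * watched q A x y := by
  unfold watched
  split_ifs with hxA hyA
  · rw [← hY.measure_inter_next hS hx y]
    congr 1
    ext ω
    refine and_congr_right fun hω => ?_
    have hN : Y N ω ∈ A := hx ω hω ▸ hxA
    constructor
    · rintro ⟨M, hM, h⟩
      exact hM.2.1 hN ▸ h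
    · exact fun h => ⟨N + 1, ⟨N.lt_succ_self, fun _ => rfl, fun h => absurd hN h⟩, h⟩
  · have hU : S ∩ {ω | ∃ M, NextVisit Y A N M ω ∧ Y M ω = y}
        = ⋃ r, S ∩ {ω | Avoids Y A N r ω ∧ Y (N + r + 1) ω = y} := by
      rw [← Set.inter_iUnion]
      ext ω
      simp only [Set.mem_inter_iff, Set.mem_iUnion, Set.mem_ofPred_eq]
      refine and_congr_right fun hω => ?_
      have hN : Y N ω ∉ A := hx ω hω ▸ hxA
      constructor
      · rintro ⟨M, hM, h⟩
        obtain ⟨r, rfl⟩ : ∃ r, M = N + r + 1 := Nat.exists_eq_add_of_lt hM.1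
        exact ⟨r, ((nextVisit_add_iff hN).1 hM).1, h⟩
      · rintro ⟨r, hr, h⟩
        exact ⟨_, (nextVisit_add_iff hN).2 ⟨hr, h ▸ hyA⟩, h⟩
    rw [hU, measure_iUnion, ← ENNReal.tsum_mul_left]
    · exact tsum_congr fun r => hY.measure_inter_avoids A r hS hx y
    · refine fun r r' hr => Set.disjoint_left.2 fun ω h h' => hr ?_
      have hN : Y N ω ∉ A := hx ω h.1 ▸ hxA
      have := ((nextVisit_add_iff hN).2 ⟨h.2.1, h.2.2 ▸ hyA⟩).unique
        ((nextVisit_add_iff hN).2 ⟨h'.2.1, h'.2.2 ▸ hyA⟩)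
      omega
    · exact fun r => (hS.measurableSet hY).inter
        (((determinedBy_avoids A N r).measurableSet hY).inter (hY.measurableSet _ _))
  · rw [mul_zero]
    convert measure_empty (μ := P)
    refine Set.eq_empty_iff_forall_notMem.2 ?_
    rintro ω ⟨hω, M, hM, h⟩
    exact hyA (h ▸ (hM.2.2 (hx ω hω ▸ hxA)).1)

/-- If the watched kernel is stochastic off `A`, the chain visits `A` at arbitrarily late times. -/
lemma IsMarkovChain.ae_exists_mem [IsFiniteMeasure P] (hY : IsMarkovChain P Y q z)
    (hA : ∀ x ∉ A, ∑ y ∈ A, watched q A x y = 1) :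
    ∀ᵐ ω ∂P, ∀ N, ∃ j, N ≤ j ∧ Y j ω ∈ A := by
  have key : ∀ N, ∀ x, ∀ᵐ ω ∂P, Y N ω = x → ∃ j, N ≤ j ∧ Y j ω ∈ A := by
    intro N x
    by_cases hxA : x ∈ A
    · exact .of_forall fun ω h => ⟨N, le_rfl, h ▸ hxA⟩
    set S : Set Ω := {ω | Y N ω = x} with hSdef
    set T : V → Set Ω := fun y => S ∩ {ω | ∃ M, NextVisit Y A N M ω ∧ Y M ω = y} with hT
    have hS : DeterminedBy Y N S := determinedBy_eq N x
    have hTm : ∀ y, MeasurableSet (T y) := fun y =>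
      (hS.measurableSet hY).inter (hY.measurableSet_nextVisit_eq A N y)
    have hP : P (⋃ y ∈ A, T y) = P S := by
      rw [measure_biUnion_finset (fun y _ y' _ hyy' => ?_) fun y _ => hTm y]
      · rw [Finset.sum_congr rfl fun y _ => hY.measure_inter_nextVisit A hS (fun _ h => h) y,
          ← Finset.mul_sum, hA x hxA, mul_one]
      · refine Set.disjoint_left.2 ?_
        rintro ω ⟨_, M, hM, h⟩ ⟨_, M', hM', h'⟩
        exact hyy' (h.symm.trans (hM.unique hM' ▸ h'))
    have hsub : ⋃ y ∈ A, T y ⊆ S := Set.iUnion₂_subset fun y _ => Set.inter_subset_left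
    have hnull : P (S \ ⋃ y ∈ A, T y) = 0 := by
      rw [measure_sdiff hsub (Finset.measurableSet_biUnion A fun y _ => hTm y).nullMeasurableSet
        (measure_ne_top _ _), hP, tsub_self]
    refine measure_mono_null (fun ω hω => ?_) hnull
    simp only [Set.mem_compl_iff, Set.mem_ofPred_eq, Classical.not_imp] at hω
    refine ⟨hω.1, fun h => hω.2 ?_⟩
    obtain ⟨y, hy, -, M, hM, rfl⟩ := Set.mem_iUnion₂.1 h
    exact ⟨M, hM.1.le, hy⟩
  filter_upwards [ae_all_iff.2 fun N => ae_all_iff.2 (key N)] with ω h N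
  exact h N _ rfl

variable {J : ℕ → Ω → ℕ}

lemma IsMarkovChain.measure_observed (hY : IsMarkovChain P Y q z) (hJ0 : ∀ ω, J 0 ω = 0)
    (hJ : ∀ k M ω, NextVisit Y A (J k ω) M ω ↔ J k ω < J (k + 1) ω ∧ J (k + 1) ω = M)
    (s : ℕ → V) (k : ℕ) :
    P (⋃ N, observed Y J s k N) = (if s 0 = z then 1 else 0) *
      ∏ i ∈ Finset.range k, watched q A (s i) (s (i + 1)) := by
  have hdet := determinedBy_observed hJ0 hJ s
  have hdisj : ∀ k, Pairwise fun N N' => Disjoint (observed Y J s k N) (observed Y J s k N') :=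
    fun k N N' h => Set.disjoint_left.2 fun ω hω hω' => h (hω.2.2.symm.trans hω'.2.2)
  induction k with
  | zero =>
    have h := hY.path 0 s
    rw [Finset.prod_range_zero] at h ⊢
    rw [← h]
    congr 1
    ext ω
    simp [observed, hJ0]
  | succ k ih =>
    have hU : ⋃ M, observed Y J s (k + 1) M = ⋃ N, observed Y J s k N ∩
        {ω | ∃ M, NextVisit Y A N M ω ∧ Y M ω = s (k + 1)} := by
      ext ω
      simp only [Set.mem_iUnion, mem_observed_succ hJ, Set.mem_inter_iff, Set.mem_ofPred_eq,
        ← exists_and_left]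
      exact exists_comm
    rw [hU, measure_iUnion (fun N N' h => (hdisj k h).mono Set.inter_subset_left
      Set.inter_subset_left) fun N => ((hdet k N).measurableSet hY).inter
        (hY.measurableSet_nextVisit_eq A N _), Finset.prod_range_succ, ← mul_assoc, ← ih,
      measure_iUnion (hdisj k) fun N => (hdet k N).measurableSet hY, ← ENNReal.tsum_mul_right]
    exact tsum_congr fun N => hY.measure_inter_nextVisit A (hdet k N)
      (fun ω hω => by rw [← hω.2.2]; exact hω.2.1 k le_rfl) _

end MarkovHitting

/-- The paper's Lemma 3.3 (consistency of the approximating Markov chains): if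
`Wm ⊆ Wn`, `Ym` is the chain with kernel `p_{Wm}` started at `z ∈ Wm`, `Yn` is the
chain with kernel `p_{Wn}` started at `z`, and `J k` are the successive times defined
by `J 0 = 0`, `J (k+1) = J k + 1` if `Yn (J k) ∈ Wm` and otherwise the first time
after `J k` at which `Yn` lies in `Wm`, then a.s. all these times are well defined
(finite), and `(Yn (J k))_k` has the same law as `(Ym k)_k`. -/
theorem stmt13 {V : Type*} [Countable V] [Infinite V]
    (c : V → V → ℝ) (hc : Conductance c)
    (Wm Wn : Finset V) (hWm : Wm.Nonempty) (hWmn : Wm ⊆ Wn)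
    (z : V) (hz : z ∈ Wm)
    -- harmonic-measure functions for the boundary sets `Wm` and `Wn`
    (Hm : V → V → ℝ)
    (hHmb : ∀ y ∈ Wm, Hm y y = 1 ∧ ∀ a ∈ Wm, a ≠ y → Hm y a = 0)
    (hHmm : ∀ y ∈ Wm, ∀ f : V → ℝ,
      (f y = 1 ∧ ∀ a ∈ Wm, a ≠ y → f a = 0) → energy c (Hm y) ≤ energy c f)
    (Hn : V → V → ℝ)
    (hHnb : ∀ y ∈ Wn, Hn y y = 1 ∧ ∀ a ∈ Wn, a ≠ y → Hn y a = 0)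
    (hHnm : ∀ y ∈ Wn, ∀ f : V → ℝ,
      (f y = 1 ∧ ∀ a ∈ Wn, a ≠ y → f a = 0) → energy c (Hn y) ≤ energy c f)
    -- the chain `Ym` with kernel `p_{Wm}` started at `z`
    {Ωm : Type*} [MeasurableSpace Ωm] (Pm : Measure Ωm) [IsProbabilityMeasure Pm]
    (Ym : ℕ → Ωm → V)
    (hYmmeas : ∀ (j : ℕ) (s : V), MeasurableSet {ω | Ym j ω = s})
    (hMarkovm : ∀ (k : ℕ) (s : ℕ → V),
      Pm {ω | ∀ i ≤ k, Ym i ω = s i} =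
        (if s 0 = z then 1 else 0) *
          ∏ i ∈ Finset.range k, ENNReal.ofReal (pW c Wm Hm (s i) (s (i + 1))))
    -- the chain `Yn` with kernel `p_{Wn}` started at `z`
    {Ωn : Type*} [MeasurableSpace Ωn] (Pn : Measure Ωn) [IsProbabilityMeasure Pn]
    (Yn : ℕ → Ωn → V)
    (hYnmeas : ∀ (j : ℕ) (s : V), MeasurableSet {ω | Yn j ω = s})
    (hMarkovn : ∀ (k : ℕ) (s : ℕ → V),
      Pn {ω | ∀ i ≤ k, Yn i ω = s i} =
        (if s 0 = z then 1 else 0) *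
          ∏ i ∈ Finset.range k, ENNReal.ofReal (pW c Wn Hn (s i) (s (i + 1))))
    -- the successive visit times of `Yn` to `Wm`
    (J : ℕ → Ωn → ℕ)
    (hJ0 : ∀ ω, J 0 ω = 0)
    (hJs : ∀ (k : ℕ) (ω : Ωn), J (k + 1) ω =
      if Yn (J k ω) ω ∈ Wm then J k ω + 1
      else sInf {j | J k ω < j ∧ Yn j ω ∈ Wm}) :
    Pn {ω | ∀ k, Yn (J k ω) ω ∈ Wm ∨ {j | J k ω < j ∧ Yn j ω ∈ Wm}.Nonempty} = 1 ∧
      ∀ (k : ℕ) (s : ℕ → V),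
        Pn {ω | ∀ i ≤ k, Yn (J i ω) ω = s i} = Pm {ω | ∀ i ≤ k, Ym i ω = s i} := by
  have hHm : DirichletForm.IsHarmonicMeasure c Wm Hm := ⟨hHmb, hHmm⟩
  have hHn : DirichletForm.IsHarmonicMeasure c Wn Hn := ⟨hHnb, hHnm⟩
  have hYn : MarkovHitting.IsMarkovChain Pn Yn (fun x y => ENNReal.ofReal (pW c Wn Hn x y)) z :=
    ⟨hYnmeas, hMarkovn⟩
  have hwatched := DirichletForm.watched_pW hc hWm hWmn hHm hHn
  have hJ : ∀ k M ω, MarkovHitting.NextVisit Yn Wm (J k ω) M ω ↔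
      J k ω < J (k + 1) ω ∧ J (k + 1) ω = M := fun k M ω => by
    rw [hJs k ω, MarkovHitting.nextVisit_iff]
  have hae : ∀ᵐ ω ∂Pn, ∀ N, ∃ j, N ≤ j ∧ Yn j ω ∈ Wm := by
    refine hYn.ae_exists_mem fun x hx => ?_
    rw [Finset.sum_congr rfl fun y _ => hwatched x y,
      ← ENNReal.ofReal_sum_of_nonneg fun y _ => DirichletForm.pW_nonneg hc hHm x y,
      Finset.sum_congr rfl fun y hy => show pW c Wm Hm x y = Hm y x by simp [pW, hx, hy],
      hHm.sum_eq_one hc hWm, ENNReal.ofReal_one]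
  constructor
  · rw [← measure_univ (μ := Pn)]
    refine measure_congr (Filter.eventuallyEq_univ.2 ?_)
    filter_upwards [hae] with ω hω k
    obtain ⟨j, hj, hjW⟩ := hω (J k ω + 1)
    exact Or.inr ⟨j, hj, hjW⟩
  · intro k s
    rw [hMarkovm k s, ← Finset.prod_congr rfl fun i _ => hwatched (s i) (s (i + 1)),
      ← hYn.measure_observed hJ0 hJ s k]
    refine measure_congr ?_
    filter_upwards [hae] with ω hω
    have hlt : ∀ i, J i ω < J (i + 1) ω := fun i => by
      obtain ⟨j, hj, hjW⟩ := hω (J i ω + 1)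
      obtain ⟨M, hM⟩ := MarkovHitting.exists_nextVisit_of_mem hj hjW
      exact ((hJ i M ω).1 hM).1
    refine propext ⟨fun h => Set.mem_iUnion.2 ⟨J k ω, fun i _ => hlt i, h, rfl⟩, fun h => ?_⟩
    obtain ⟨N, hN⟩ := Set.mem_iUnion.1 h
    exact hN.2.1
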